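/- Let X be a Hausdorff space and set κ = skL(X, 2^{ψ(X)·t(X)}) · ψ(X) · t(X). Then |X| ≤ d(X)^κ. -/

import Mathlib

open Cardinal Set

universe u

/-- Skew-λ Lindelöf degree of `A` in `X`. -/
noncomputable def skLrel (X : Type u) [TopologicalSpace X] (A : Set X) (lam : Cardinal.{u}) :
    Cardinal.{u} :=
  sInf {κ : Cardinal.{u} | ℵ₀ ≤ κ ∧
    ∀ 𝒰 : Set (Set X), (∀ U ∈ 𝒰, IsOpen U) → A ⊆ ⋃₀ 𝒰 →
      ∃ 𝒱 ⊆ 𝒰, #↥𝒱 ≤ κ ∧ #↥(A \ ⋃₀ 𝒱) < lam}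

/-- Skew-λ Lindelöf degree of `X`. -/
noncomputable def skL (X : Type u) [TopologicalSpace X] (lam : Cardinal.{u}) : Cardinal.{u} :=
  skLrel X Set.univ lam

/-- Lindelöf degree of `X`. -/
noncomputable def Ldeg (X : Type u) [TopologicalSpace X] : Cardinal.{u} :=
  sInf {κ : Cardinal.{u} | ℵ₀ ≤ κ ∧
    ∀ 𝒰 : Set (Set X), (∀ U ∈ 𝒰, IsOpen U) → ⋃₀ 𝒰 = Set.univ →
      ∃ 𝒱 ⊆ 𝒰, #↥𝒱 ≤ κ ∧ ⋃₀ 𝒱 = Set.univ}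

/-- Pseudocharacter of `X`. -/
noncomputable def psi (X : Type u) [TopologicalSpace X] : Cardinal.{u} :=
  sInf {κ : Cardinal.{u} | ℵ₀ ≤ κ ∧
    ∀ x : X, ∃ 𝒱 : Set (Set X), (∀ V ∈ 𝒱, IsOpen V) ∧ #↥𝒱 ≤ κ ∧ ⋂₀ 𝒱 = {x}}

/-- Closed pseudocharacter of `X`. -/
noncomputable def psic (X : Type u) [TopologicalSpace X] : Cardinal.{u} :=
  sInf {κ : Cardinal.{u} | ℵ₀ ≤ κ ∧
    ∀ x : X, ∃ 𝒱 : Set (Set X), (∀ V ∈ 𝒱, IsOpen V ∧ x ∈ V) ∧ #↥𝒱 ≤ κ ∧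
      (⋂ V ∈ 𝒱, closure V) = {x}}

/-- Tightness of `X`. -/
noncomputable def tight (X : Type u) [TopologicalSpace X] : Cardinal.{u} :=
  sInf {κ : Cardinal.{u} | ℵ₀ ≤ κ ∧
    ∀ (A : Set X) (x : X), x ∈ closure A → ∃ B ⊆ A, #↥B ≤ κ ∧ x ∈ closure B}

/-- Character of `X`. -/
noncomputable def charDeg (X : Type u) [TopologicalSpace X] : Cardinal.{u} :=
  sInf {κ : Cardinal.{u} | ℵ₀ ≤ κ ∧
    ∀ x : X, ∃ ℬ : Set (Set X), (∀ B ∈ ℬ, IsOpen B ∧ x ∈ B) ∧ #↥ℬ ≤ κ ∧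
      ∀ U : Set X, IsOpen U → x ∈ U → ∃ B ∈ ℬ, B ⊆ U}

/-- Density of `X`. -/
noncomputable def dens (X : Type u) [TopologicalSpace X] : Cardinal.{u} :=
  sInf {κ : Cardinal.{u} | ℵ₀ ≤ κ ∧ ∃ D : Set X, Dense D ∧ #↥D ≤ κ}

/-- θ-network weight of `X`. -/
noncomputable def nwTheta (X : Type u) [TopologicalSpace X] : Cardinal.{u} :=
  sInf {κ : Cardinal.{u} | ℵ₀ ≤ κ ∧
    ∃ 𝒩 : Set (Set X), 𝒩.Nonempty ∧ #↥𝒩 ≤ κ ∧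
      ∀ (x : X) (U : Set X), IsOpen U → x ∈ U → ∃ N ∈ 𝒩, x ∈ N ∧ N ⊆ closure U}

/-- Skew-λ almost Lindelöf degree of `A` in `X`. -/
noncomputable def saLrel (X : Type u) [TopologicalSpace X] (A : Set X) (lam : Cardinal.{u}) :
    Cardinal.{u} :=
  sInf {κ : Cardinal.{u} | ℵ₀ ≤ κ ∧
    ∀ 𝒰 : Set (Set X), (∀ U ∈ 𝒰, IsOpen U) → A ⊆ ⋃₀ 𝒰 →
      ∃ 𝒱 ⊆ 𝒰, #↥𝒱 ≤ κ ∧ #↥(A \ ⋃ V ∈ 𝒱, closure V) < lam}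

/-- Skew-λ almost Lindelöf degree of `X`. -/
noncomputable def saL (X : Type u) [TopologicalSpace X] (lam : Cardinal.{u}) : Cardinal.{u} :=
  saLrel X Set.univ lam

/-- Skew-λ almost Lindelöf degree of `X` with respect to closed sets. -/
noncomputable def saLc (X : Type u) [TopologicalSpace X] (lam : Cardinal.{u}) : Cardinal.{u} :=
  sSup {c : Cardinal.{u} | ∃ A : Set X, IsClosed A ∧ c = saLrel X A lam}

/-- κ-closure of a set. -/
def clk {X : Type u} [TopologicalSpace X] (κ : Cardinal.{u}) (A : Set X) : Set X :=
  ⋃ B ∈ {B : Set X | B ⊆ A ∧ #↥B ≤ κ}, closure B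

/-- Skew-λ almost Lindelöf degree of `X` with respect to κ-closed sets. -/
noncomputable def saLk (X : Type u) [TopologicalSpace X] (κ lam : Cardinal.{u}) : Cardinal.{u} :=
  sSup {c : Cardinal.{u} | ∃ A : Set X, clk κ A = A ∧ c = saLrel X A lam}

/-- Skew-λ weak Lindelöf degree of `A` in `X`. -/
noncomputable def swLrel (X : Type u) [TopologicalSpace X] (A : Set X) (lam : Cardinal.{u}) :
    Cardinal.{u} :=
  sInf {κ : Cardinal.{u} | ℵ₀ ≤ κ ∧
    ∀ 𝒰 : Set (Set X), (∀ U ∈ 𝒰, IsOpen U) → A ⊆ ⋃₀ 𝒰 →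
      ∃ 𝒱 ⊆ 𝒰, #↥𝒱 ≤ κ ∧ #↥(A \ closure (⋃₀ 𝒱)) < lam}

/-- Skew-λ weak Lindelöf degree of `X`. -/
noncomputable def swL (X : Type u) [TopologicalSpace X] (lam : Cardinal.{u}) : Cardinal.{u} :=
  swLrel X Set.univ lam

/-- Skew-λ weak Lindelöf degree of `X` with respect to closed sets. -/
noncomputable def swLc (X : Type u) [TopologicalSpace X] (lam : Cardinal.{u}) : Cardinal.{u} :=
  sSup {c : Cardinal.{u} | ∃ A : Set X, IsClosed A ∧ c = swLrel X A lam}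


theorem exists_range_eq {α K : Type u} (S : Set α) (hS : S.Nonempty) (h : #S ≤ #K) :
    ∃ f : K → α, range f = S := by
  obtain ⟨e⟩ := Cardinal.le_def _ _ |>.1 h
  have : Nonempty S := hS.to_subtype
  refine ⟨fun k => (Function.invFun e k : S), ?_⟩
  ext y
  constructor
  · rintro ⟨k, rfl⟩
    exact (Function.invFun e k).2
  · intro hy
    refine ⟨e ⟨y, hy⟩, ?_⟩
    simp [Function.leftInverse_invFun e.injective ⟨y, hy⟩]

theorem psi_spec (X : Type u) [TopologicalSpace X] [T2Space X] : ℵ₀ ≤ psi X ∧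
    ∀ x : X, ∃ 𝒱 : Set (Set X), (∀ V ∈ 𝒱, IsOpen V) ∧ #↥𝒱 ≤ psi X ∧ ⋂₀ 𝒱 = {x} := by
  refine csInf_mem (s := {κ : Cardinal.{u} | ℵ₀ ≤ κ ∧
    ∀ x : X, ∃ 𝒱 : Set (Set X), (∀ V ∈ 𝒱, IsOpen V) ∧ #↥𝒱 ≤ κ ∧ ⋂₀ 𝒱 = {x}})
    ⟨max ℵ₀ #(Set X), le_max_left _ _, fun x => ⟨{V | IsOpen V ∧ x ∈ V}, fun V h => h.1,
      (mk_set_le _).trans (le_max_right _ _), ?_⟩⟩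
  ext y
  simp only [mem_sInter, mem_setOf_eq, mem_singleton_iff]
  constructor
  · intro h
    by_contra hne
    exact h {y}ᶜ ⟨isOpen_compl_singleton, fun h' => hne h'.symm⟩ rfl
  · rintro rfl V h
    exact h.2

theorem tight_spec (X : Type u) [TopologicalSpace X] : ℵ₀ ≤ tight X ∧
    ∀ (A : Set X) (x : X), x ∈ closure A → ∃ B ⊆ A, #↥B ≤ tight X ∧ x ∈ closure B :=
  csInf_mem (s := {κ : Cardinal.{u} | ℵ₀ ≤ κ ∧
    ∀ (A : Set X) (x : X), x ∈ closure A → ∃ B ⊆ A, #↥B ≤ κ ∧ x ∈ closure B})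
    ⟨max ℵ₀ #X, le_max_left _ _, fun A _ hx => ⟨A, Subset.rfl,
      (mk_set_le _).trans (le_max_right _ _), hx⟩⟩

theorem dens_spec (X : Type u) [TopologicalSpace X] :
    ℵ₀ ≤ dens X ∧ ∃ D : Set X, Dense D ∧ #↥D ≤ dens X :=
  csInf_mem (s := {κ : Cardinal.{u} | ℵ₀ ≤ κ ∧ ∃ D : Set X, Dense D ∧ #↥D ≤ κ})
    ⟨max ℵ₀ #X, le_max_left _ _, Set.univ, dense_univ, (mk_set_le _).trans (le_max_right _ _)⟩

theorem skL_spec (X : Type u) [TopologicalSpace X] (lam : Cardinal.{u}) (hl : 0 < lam) :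
    ℵ₀ ≤ skL X lam ∧
    ∀ 𝒰 : Set (Set X), (∀ U ∈ 𝒰, IsOpen U) → Set.univ ⊆ ⋃₀ 𝒰 →
      ∃ 𝒱 ⊆ 𝒰, #↥𝒱 ≤ skL X lam ∧ #↥(Set.univ \ ⋃₀ 𝒱) < lam := by
  refine csInf_mem (s := {κ : Cardinal.{u} | ℵ₀ ≤ κ ∧
    ∀ 𝒰 : Set (Set X), (∀ U ∈ 𝒰, IsOpen U) → Set.univ ⊆ ⋃₀ 𝒰 →
      ∃ 𝒱 ⊆ 𝒰, #↥𝒱 ≤ κ ∧ #↥(Set.univ \ ⋃₀ 𝒱) < lam})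
    ⟨max ℵ₀ #(Set X), le_max_left _ _, fun 𝒰 _ hc => ⟨𝒰, Subset.rfl,
      (mk_set_le _).trans (le_max_right _ _), ?_⟩⟩
  rw [diff_eq_empty.2 hc]
  simpa using hl

theorem key_family {X : Type u} [TopologicalSpace X] [T2Space X] (κ lam : Cardinal.{u})
    (hκ : ℵ₀ ≤ κ) (hlam : lam ≤ 2 ^ κ) (hl : 0 < lam) (h1 : psi X ≤ κ) (h2 : skL X lam ≤ κ)
    (x : X) : ∃ 𝒲 : Set (Set X), 𝒲.Nonempty ∧ #𝒲 ≤ κ ∧ (∀ W ∈ 𝒲, IsOpen W ∧ x ∈ W) ∧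
      #↥(⋂ W ∈ 𝒲, closure W) ≤ 2 ^ κ := by
  obtain ⟨𝒱, hVo, hVc, hVx⟩ := (psi_spec X).2 x
  have step : ∀ V : 𝒱, ∃ 𝒢 ⊆ insert V.1 {U : Set X | IsOpen U ∧ x ∉ closure U},
      #𝒢 ≤ skL X lam ∧ #↥(Set.univ \ ⋃₀ 𝒢) < lam := by
    intro V
    apply (skL_spec X lam hl).2
    · rintro U (rfl | hU)
      · exact hVo _ V.2
      · exact hU.1
    · intro y _
      by_cases hy : y = x
      · refine ⟨V.1, mem_insert _ _, ?_⟩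
        have : x ∈ ⋂₀ 𝒱 := by rw [hVx]; rfl
        rw [hy]
        exact this _ V.2
      · obtain ⟨A, B, hA, hB, hyA, hxB, hd⟩ := t2_separation hy
        refine ⟨A, Or.inr ⟨hA, fun hc => ?_⟩, hyA⟩
        obtain ⟨z, hz1, hz2⟩ := mem_closure_iff.1 hc B hB hxB
        exact disjoint_left.1 hd hz2 hz1
  choose 𝒢 hGs hGc hGr using step
  let 𝒜 : Set (Set X) := ⋃ V : 𝒱, {U ∈ 𝒢 V | x ∉ closure U}
  have h𝒱κ : #𝒱 ≤ κ := hVc.trans h1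
  have hA : #𝒜 ≤ κ := by
    refine (mk_iUnion_le _).trans ?_
    refine (mul_le_mul' h𝒱κ (ciSup_le' (a := κ) fun V => ?_)).trans (mul_eq_self hκ).le
    exact (mk_le_mk_of_subset (sep_subset _ _)).trans ((hGc V).trans h2)
  refine ⟨insert Set.univ ((fun U => (closure U)ᶜ) '' 𝒜), insert_nonempty _ _, ?_, ?_, ?_⟩
  · refine mk_insert_le.trans ((add_le_add_left (mk_image_le.trans hA) 1).trans ?_)
    rw [add_one_eq hκ]
  · rintro W (rfl | ⟨U, hU, rfl⟩)
    · exact ⟨isOpen_univ, mem_univ _⟩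
    · refine ⟨isClosed_closure.isOpen_compl, ?_⟩
      obtain ⟨V, hV⟩ := mem_iUnion.1 hU
      exact hV.2
  · have hsub : (⋂ W ∈ insert Set.univ ((fun U => (closure U)ᶜ) '' 𝒜), closure W) ⊆
        insert x (⋃ V : 𝒱, (Set.univ \ ⋃₀ 𝒢 V)) := by
      intro y hy
      by_cases hyx : y = x
      · exact Or.inl hyx
      right
      have : y ∉ ⋂₀ 𝒱 := by rw [hVx]; exact hyx
      simp only [mem_sInter, not_forall] at this
      obtain ⟨V, hV, hyV⟩ := this
      refine mem_iUnion.2 ⟨⟨V, hV⟩, mem_univ _, ?_⟩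
      rintro ⟨U, hU, hyU⟩
      rcases hGs _ hU with h | h
      · exact hyV ((show U = V from h) ▸ hyU)
      · have hUA : U ∈ 𝒜 := mem_iUnion.2 ⟨⟨V, hV⟩, hU, h.2⟩
        have hy' := mem_iInter₂.1 hy _ (Or.inr ⟨U, hUA, rfl⟩)
        obtain ⟨z, hz1, hz2⟩ := mem_closure_iff.1 hy' U h.1 hyU
        exact hz2 (subset_closure hz1)
    have h2κ : ℵ₀ ≤ (2 : Cardinal.{u}) ^ κ := hκ.trans (cantor κ).le
    refine (mk_le_mk_of_subset hsub).trans (mk_insert_le.trans ?_)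
    rw [← add_one_eq h2κ]
    refine add_le_add_left ((mk_iUnion_le _).trans ?_) 1
    refine (mul_le_mul' (h𝒱κ.trans (cantor κ).le) (ciSup_le' (a := 2 ^ κ) fun V => ?_)).trans
      (mul_eq_self h2κ).le
    exact (hGr V).le.trans hlam

/-- Lemma 3.6: for κ = skL(X,2^{ψ(X)·t(X)})·ψ(X)·t(X), |X| ≤ d(X)^κ. -/
theorem lemmaC {X : Type u} [TopologicalSpace X] [T2Space X] :
    #X ≤ dens X ^ (skL X (2 ^ (psi X * tight X)) * psi X * tight X) := by
  have hp := (psi_spec X).1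
  have ht := (tight_spec X).1
  have hl : (0 : Cardinal.{u}) < 2 ^ (psi X * tight X) :=
    pos_iff_ne_zero.2 (power_ne_zero _ two_ne_zero)
  have hs := (skL_spec X _ hl).1
  generalize hk : skL X (2 ^ (psi X * tight X)) * psi X * tight X = κ
  have hp0 : psi X ≠ 0 := (aleph0_pos.trans_le hp).ne'
  have ht0 : tight X ≠ 0 := (aleph0_pos.trans_le ht).ne'
  have hs0 : skL X (2 ^ (psi X * tight X)) ≠ 0 := (aleph0_pos.trans_le hs).ne'
  have htκ : tight X ≤ κ := hk ▸ Cardinal.le_mul_left (mul_ne_zero hs0 hp0)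
  have hsκ : skL X (2 ^ (psi X * tight X)) ≤ κ := by
    rw [← hk, mul_assoc]; exact Cardinal.le_mul_right (mul_ne_zero hp0 ht0)
  have hptκ : psi X * tight X ≤ κ := by
    rw [← hk, mul_assoc]; exact Cardinal.le_mul_left hs0
  have hpκ : psi X ≤ κ := (Cardinal.le_mul_right ht0).trans hptκ
  have hκ : ℵ₀ ≤ κ := ht.trans htκ
  obtain ⟨hd, D, hD, hDc⟩ := dens_spec X
  clear hk
  induction κ using Cardinal.inductionOn with | _ K
  have ex : ∀ x : X, ∃ g : K → K → D,
      x ∈ (⋂ i, closure (range fun j => (g i j : X))) ∧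
      #↥(⋂ i, closure (range fun j => (g i j : X))) ≤ 2 ^ #K := by
    intro x
    obtain ⟨𝒲, hne, hWc, hWo, hWi⟩ := key_family #K _ hκ
      (power_le_power_left two_ne_zero hptκ) hl hpκ hsκ x
    obtain ⟨w, hw⟩ := exists_range_eq 𝒲 hne hWc
    have : ∀ i, ∃ g : K → D, x ∈ closure (range fun j => (g j : X)) ∧
        closure (range fun j => (g j : X)) ⊆ closure (w i) := by
      intro i
      obtain ⟨ho, hx⟩ := hWo (w i) (hw ▸ mem_range_self i)
      have hxc : x ∈ closure (w i ∩ D) := hD.open_subset_closure_inter ho hx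
      obtain ⟨B, hBs, hBc, hxB⟩ := (tight_spec X).2 _ _ hxc
      have hBne : B.Nonempty := closure_nonempty_iff.1 ⟨x, hxB⟩
      obtain ⟨f, hf⟩ := exists_range_eq (K := K) B hBne (hBc.trans htκ)
      have hfB : ∀ j, f j ∈ B := fun j => hf ▸ mem_range_self j
      refine ⟨fun j => ⟨f j, (hBs (hfB j)).2⟩, ?_, ?_⟩
      · change x ∈ closure (range f)
        rwa [hf]
      · change closure (range f) ⊆ _
        rw [hf]
        exact closure_mono (hBs.trans inter_subset_left)
    choose g hg1 hg2 using this
    refine ⟨g, mem_iInter.2 hg1, (mk_le_mk_of_subset ?_).trans hWi⟩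
    refine subset_iInter₂ fun W hW => ?_
    obtain ⟨i, rfl⟩ := hw.symm ▸ hW
    exact (iInter_subset _ i).trans (hg2 i)
  choose G hG1 hG2 using ex
  have hdK : ℵ₀ ≤ dens X ^ #K := hκ.trans ((cantor _).le.trans
    (power_le_power_right ((nat_lt_aleph0 2).le.trans hd)))
  have hfun : #(K → K → D) ≤ dens X ^ #K := by
    rw [← power_def, ← power_def, ← power_mul, mul_eq_self hκ]
    exact power_le_power_right hDc
  rw [mk_congr (Equiv.sigmaFiberEquiv G).symm, mk_sigma]
  refine (sum_le_mk_mul_iSup _).trans ?_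
  refine (mul_le_mul' hfun (ciSup_le' (a := dens X ^ #K) fun g => ?_)).trans (mul_eq_self hdK).le
  refine le_trans ?_ (power_le_power_right (a := 2) ((nat_lt_aleph0 2).le.trans hd))
  by_cases h : Nonempty {x // G x = g}
  · obtain ⟨x0, rfl⟩ := h
    refine le_trans (mk_le_mk_of_subset (s := {x | G x = G x0}) fun x hx => ?_) (hG2 x0)
    have := hG1 x
    rwa [show G x = G x0 from hx] at this
  · have := not_nonempty_iff.1 h
    simp
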